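/- Suppose Assumption A holds. Then for every a ∈ [0, ā], the equation g_a(y) = 0 has a unique solution d(a) ∈ [0, M], where g_a(y) = (1+η)𝔼[(X − y)⁺ − (X − y − (S+a))⁺] − a. In particular, for every a ∈ (0, ā], g_a is strictly decreasing on [0, M], and d(0) = M. -/

import Mathlib

open MeasureTheory Set

noncomputable section

variable {Ω : Type*} [MeasurableSpace Ω]
/-- Full-insurance premium `π_f = (1+η)𝔼[X]`. -/
def piFull (ℙ : Measure Ω) (η : ℝ) (X : Ω → ℝ) : ℝ := (1 + η) * ∫ ω, X ω ∂ℙ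

/-- `g(a) = (1+η)·𝔼[X − (X − (S+a)⁺)⁺] − a`. -/
def gfun (ℙ : Measure Ω) (η : ℝ) (X S : Ω → ℝ) (a : ℝ) : ℝ :=
  (1 + η) * ∫ ω, (X ω - max (X ω - max (S ω + a) 0) 0) ∂ℙ - a

/-- `ā = inf {a ∈ [0, π_f] : g(a) ≤ 0}`. -/
def abar (ℙ : Measure Ω) (η : ℝ) (X S : Ω → ℝ) : ℝ :=
  sInf {a | a ∈ Icc 0 (piFull ℙ η X) ∧ gfun ℙ η X S a ≤ 0}

/-- Distribution function of a random variable. -/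
def distFn (ℙ : Measure Ω) (Y : Ω → ℝ) (t : ℝ) : ℝ := (ℙ {ω | Y ω ≤ t}).toReal

/-- The set of discontinuity points in `[0, M]` of the distribution function of `Y`. -/
def JumpSet (ℙ : Measure Ω) (Y : Ω → ℝ) (M : ℝ) : Set ℝ :=
  {x ∈ Icc (0 : ℝ) M | ¬ ContinuousAt (distFn ℙ Y) x}

/-- Assumption A: (1) `S ≥ 0` a.s.; (2) the distribution functions of `X` and of `X − S`
have finitely many discontinuity points in `[0, M]`; (3) the distribution function of `X`
is strictly increasing on `[0, M]`; (4) `𝔼[(X − y)⁺ − (X − y − S)⁺] > 0` for `y ∈ [0, M)`. -/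
def AssumpA (ℙ : Measure Ω) (X S : Ω → ℝ) (M : ℝ) : Prop :=
  (∀ᵐ ω ∂ℙ, 0 ≤ S ω) ∧
  (JumpSet ℙ X M).Finite ∧
  (JumpSet ℙ (fun ω => X ω - S ω) M).Finite ∧
  StrictMonoOn (distFn ℙ X) (Icc 0 M) ∧
  ∀ y ∈ Ico (0 : ℝ) M, 0 < ∫ ω, (max (X ω - y) 0 - max (X ω - y - S ω) 0) ∂ℙ

/-- `g_a(y) = (1+η)·𝔼[(X − y)⁺ − (X − y − (S+a))⁺] − a`. -/
def gA (ℙ : Measure Ω) (η : ℝ) (X S : Ω → ℝ) (a y : ℝ) : ℝ :=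
  (1 + η) * ∫ ω, (max (X ω - y) 0 - max (X ω - y - (S ω + a)) 0) ∂ℙ - a

theorem ae_le_of_essSup_eq_pos {ℙ : Measure Ω} {X : Ω → ℝ} {M : ℝ}
    (hM : essSup X ℙ = M) (hM0 : 0 < M) : ∀ᵐ ω ∂ℙ, X ω ≤ M := by
  have hbdd : Filter.IsBoundedUnder (· ≤ ·) (ae ℙ) X := by
    by_contra h
    have hempty : {a : ℝ | ∀ᵐ ω ∂ℙ, X ω ≤ a} = ∅ :=
      eq_empty_of_forall_notMem fun a ha => h (Filter.isBoundedUnder_of_eventually_le ha)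
    rw [essSup, Filter.limsup_eq, hempty, Real.sInf_empty] at hM
    exact hM0.ne hM
  exact hM ▸ ae_le_essSup hbdd

/-- The layer `(x - y)⁺ - (x - y - c)⁺` lies between `0` and `x`. -/
theorem layer_mem_Icc {x y c : ℝ} (hx : 0 ≤ x) (hy : 0 ≤ y) (hc : 0 ≤ c) :
    max (x - y) 0 - max (x - y - c) 0 ∈ Icc 0 x := by
  constructor <;> grind

section Layer

variable {ℙ : Measure Ω} {X S : Ω → ℝ} {M η a : ℝ}

theorem measurable_layer (hXm : Measurable X) (hSm : Measurable S) (a y : ℝ) :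
    Measurable fun ω => max (X ω - y) 0 - max (X ω - y - (S ω + a)) 0 := by
  fun_prop

theorem norm_layer_le (hX0 : ∀ ω, 0 ≤ X ω) (hXM : ∀ᵐ ω ∂ℙ, X ω ≤ M) (hS : ∀ᵐ ω ∂ℙ, 0 ≤ S ω)
    {y : ℝ} (ha : 0 ≤ a) (hy : 0 ≤ y) :
    ∀ᵐ ω ∂ℙ, ‖max (X ω - y) 0 - max (X ω - y - (S ω + a)) 0‖ ≤ M := by
  filter_upwards [hXM, hS] with ω hω hsω
  have h := layer_mem_Icc (hX0 ω) hy (add_nonneg hsω ha)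
  rw [Real.norm_of_nonneg h.1]
  exact h.2.trans hω

/-- The function `g_a` starts at the value `g(a)`. -/
theorem gA_zero_right (hX0 : ∀ ω, 0 ≤ X ω) (hS : ∀ᵐ ω ∂ℙ, 0 ≤ S ω) (ha : 0 ≤ a) :
    gA ℙ η X S a 0 = gfun ℙ η X S a := by
  unfold gA gfun
  congr 2
  refine integral_congr_ae ?_
  filter_upwards [hS] with ω hω
  simp only [sub_zero, max_eq_left (hX0 ω), max_eq_left (add_nonneg hω ha)]

/-- The layer above the essential supremum is worthless. -/
theorem gA_right_end (hXM : ∀ᵐ ω ∂ℙ, X ω ≤ M) (hS : ∀ᵐ ω ∂ℙ, 0 ≤ S ω) (ha : 0 ≤ a) :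
    gA ℙ η X S a M = -a := by
  have h : ∫ ω, (max (X ω - M) 0 - max (X ω - M - (S ω + a)) 0) ∂ℙ = 0 := by
    refine integral_eq_zero_of_ae ?_
    filter_upwards [hXM, hS] with ω hω hsω
    rw [max_eq_right (by linarith), max_eq_right (by linarith)]
    simp
  simp [gA, h]

variable [IsProbabilityMeasure ℙ]

theorem integrable_layer (hXm : Measurable X) (hSm : Measurable S) (hX0 : ∀ ω, 0 ≤ X ω)
    (hXM : ∀ᵐ ω ∂ℙ, X ω ≤ M) (hS : ∀ᵐ ω ∂ℙ, 0 ≤ S ω) {y : ℝ} (ha : 0 ≤ a) (hy : 0 ≤ y) :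
    Integrable (fun ω => max (X ω - y) 0 - max (X ω - y - (S ω + a)) 0) ℙ :=
  Integrable.of_bound (measurable_layer hXm hSm a y).aestronglyMeasurable M
    (norm_layer_le hX0 hXM hS ha hy)

theorem continuousOn_gA (hXm : Measurable X) (hSm : Measurable S) (hX0 : ∀ ω, 0 ≤ X ω)
    (hXM : ∀ᵐ ω ∂ℙ, X ω ≤ M) (hS : ∀ᵐ ω ∂ℙ, 0 ≤ S ω) :
    ContinuousOn (fun p : ℝ × ℝ => gA ℙ η X S p.1 p.2) (Ici 0 ×ˢ Ici 0) := by
  unfold gA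
  refine (continuousOn_const.mul ?_).sub continuousOn_fst
  refine continuousOn_of_dominated (bound := fun _ => M)
    (fun p _ => (measurable_layer hXm hSm p.1 p.2).aestronglyMeasurable)
    (fun p hp => norm_layer_le hX0 hXM hS hp.1 hp.2) (integrable_const M)
    (Filter.Eventually.of_forall fun ω => ?_)
  fun_prop

theorem strictAntiOn_gA (hXm : Measurable X) (hSm : Measurable S) (hX0 : ∀ ω, 0 ≤ X ω)
    (hXM : ∀ᵐ ω ∂ℙ, X ω ≤ M) (hS : ∀ᵐ ω ∂ℙ, 0 ≤ S ω) (hη : 0 ≤ η)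
    (hF : StrictMonoOn (distFn ℙ X) (Icc 0 M)) (ha : 0 < a) :
    StrictAntiOn (gA ℙ η X S a) (Icc 0 M) := by
  intro y hy z hz hyz
  have hle : (fun ω => max (X ω - z) 0 - max (X ω - z - (S ω + a)) 0) ≤ᵐ[ℙ]
      fun ω => max (X ω - y) 0 - max (X ω - y - (S ω + a)) 0 := by
    filter_upwards [hS] with ω hω
    grind
  have hiy := integrable_layer hXm hSm hX0 hXM hS ha.le hy.1
  have hiz := integrable_layer hXm hSm hX0 hXM hS ha.le hz.1
  have hlt : ∫ ω, (max (X ω - z) 0 - max (X ω - z - (S ω + a)) 0) ∂ℙ <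
      ∫ ω, (max (X ω - y) 0 - max (X ω - y - (S ω + a)) 0) ∂ℙ := by
    refine (integral_mono_ae hiz hiy hle).lt_of_ne fun heq => (hF hy hz hyz).ne ?_
    have hae := (integral_eq_iff_of_ae_le hiz hiy hle).1 heq
    unfold distFn
    congr 1
    refine measure_congr ?_
    filter_upwards [hae, hS] with ω hω hsω
    refine propext (?_ : X ω ≤ y ↔ X ω ≤ z)
    refine ⟨fun h => h.trans hyz.le, fun h => ?_⟩
    grind
  have hpos : 0 < 1 + η := by linarith
  unfold gA
  linarith [mul_lt_mul_of_pos_left hlt hpos]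

theorem gfun_piFull_nonpos (hXm : Measurable X) (hX0 : ∀ ω, 0 ≤ X ω)
    (hXM : ∀ᵐ ω ∂ℙ, X ω ≤ M) (hη : 0 ≤ η) : gfun ℙ η X S (piFull ℙ η X) ≤ 0 := by
  have hXi : Integrable X ℙ := by
    refine Integrable.of_bound hXm.aestronglyMeasurable M ?_
    filter_upwards [hXM] with ω hω
    rwa [Real.norm_of_nonneg (hX0 ω)]
  have h : ∫ ω, (X ω - max (X ω - max (S ω + piFull ℙ η X) 0) 0) ∂ℙ ≤ ∫ ω, X ω ∂ℙ := by
    refine integral_mono_of_nonneg (Filter.Eventually.of_forall fun ω => ?_) hXi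
      (Filter.Eventually.of_forall fun ω => ?_)
    · have := hX0 ω
      simp only [Pi.zero_apply]
      grind
    · simp
  exact sub_nonpos.2 (mul_le_mul_of_nonneg_left h (by linarith))

theorem gA_zero_right_nonneg (hXm : Measurable X) (hSm : Measurable S) (hX0 : ∀ ω, 0 ≤ X ω)
    (hXM : ∀ᵐ ω ∂ℙ, X ω ≤ M) (hS : ∀ᵐ ω ∂ℙ, 0 ≤ S ω) (hη : 0 ≤ η)
    (ha : a ∈ Icc 0 (abar ℙ η X S)) : 0 ≤ gA ℙ η X S a 0 := by
  have hpi : 0 ≤ piFull ℙ η X :=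
    mul_nonneg (by linarith) (integral_nonneg hX0)
  have hbdd : BddBelow {a | a ∈ Icc 0 (piFull ℙ η X) ∧ gfun ℙ η X S a ≤ 0} :=
    ⟨0, fun _ h => h.1.1⟩
  have hle : abar ℙ η X S ≤ piFull ℙ η X :=
    csInf_le hbdd ⟨right_mem_Icc.2 hpi, gfun_piFull_nonpos hXm hX0 hXM hη⟩
  have hbelow : ∀ b ∈ Ico 0 (abar ℙ η X S), 0 ≤ gA ℙ η X S b 0 := by
    intro b hb
    rw [gA_zero_right hX0 hS hb.1]
    by_contra! hneg
    exact notMem_of_lt_csInf hb.2 hbdd ⟨⟨hb.1, hb.2.le.trans hle⟩, hneg.le⟩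
  rcases (ha.1.trans ha.2).eq_or_lt with h0 | h0
  · obtain rfl : a = 0 := le_antisymm (h0 ▸ ha.2) ha.1
    have : 0 ≤ ∫ ω, (max (X ω - 0) 0 - max (X ω - 0 - (S ω + 0)) 0) ∂ℙ := by
      refine integral_nonneg_of_ae ?_
      filter_upwards [hS] with ω hω
      exact (layer_mem_Icc (hX0 ω) le_rfl (add_nonneg hω le_rfl)).1
    unfold gA
    rw [sub_zero]
    exact mul_nonneg (by linarith) this
  · have hcl : closure (Ico 0 (abar ℙ η X S)) = Icc 0 (abar ℙ η X S) := closure_Ico h0.ne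
    refine le_on_closure hbelow continuousOn_const ?_ (hcl ▸ ha)
    rw [hcl]
    exact (continuousOn_gA hXm hSm hX0 hXM hS).comp
      (Continuous.prodMk_left (0 : ℝ)).continuousOn fun b hb => ⟨hb.1, self_mem_Ici⟩

end Layer

/-- under Assumption A, for every `a ∈ [0, ā]` the equation `g_a(y) = 0` has a
unique solution `d(a) ∈ [0, M]`; moreover for `a ∈ (0, ā]` the function `g_a` is strictly
decreasing on `[0, M]`, and `d(0) = M`. -/
theorem stmt8
    (ℙ : Measure Ω) [IsProbabilityMeasure ℙ]
    (X S : Ω → ℝ) (hXm : Measurable X) (hSm : Measurable S)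
    (hX0 : ∀ ω, 0 ≤ X ω) (M : ℝ) (hM : essSup X ℙ = M) (hM0 : 0 < M)
    (η : ℝ) (hη : 0 ≤ η)
    (hA : AssumpA ℙ X S M) :
    (∀ a ∈ Icc 0 (abar ℙ η X S), ∃! d : ℝ, d ∈ Icc (0 : ℝ) M ∧ gA ℙ η X S a d = 0) ∧
    (∀ a ∈ Ioc 0 (abar ℙ η X S), StrictAntiOn (gA ℙ η X S a) (Icc (0 : ℝ) M)) ∧
    gA ℙ η X S 0 M = 0 := by
  obtain ⟨hS, -, -, hF, hpos⟩ := hA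
  have hXM := ae_le_of_essSup_eq_pos hM hM0
  have hanti : ∀ a ∈ Ioc 0 (abar ℙ η X S), StrictAntiOn (gA ℙ η X S a) (Icc 0 M) :=
    fun a ha => strictAntiOn_gA hXm hSm hX0 hXM hS hη hF ha.1
  have hend : gA ℙ η X S 0 M = 0 := by rw [gA_right_end hXM hS le_rfl, neg_zero]
  refine ⟨fun a ha => ?_, hanti, hend⟩
  rcases ha.1.eq_or_lt with rfl | ha0
  · refine ⟨M, ⟨right_mem_Icc.2 hM0.le, hend⟩, fun d ⟨hd, hd0⟩ => ?_⟩
    by_contra hne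
    have hint := hpos d ⟨hd.1, lt_of_le_of_ne hd.2 hne⟩
    have hη' : 0 < 1 + η := by linarith
    simp only [gA, add_zero, sub_zero] at hd0
    exact (mul_pos hη' hint).ne' hd0
  · have hcont : ContinuousOn (gA ℙ η X S a) (Icc 0 M) :=
      (continuousOn_gA hXm hSm hX0 hXM hS).comp
        (Continuous.prodMk_right a).continuousOn fun y hy => ⟨ha.1, hy.1⟩
    have hmem : (0 : ℝ) ∈ Icc (gA ℙ η X S a M) (gA ℙ η X S a 0) :=
      ⟨by rw [gA_right_end hXM hS ha.1]; linarith,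
        gA_zero_right_nonneg hXm hSm hX0 hXM hS hη ha⟩
    obtain ⟨d, hd, hd0⟩ := intermediate_value_Icc' hM0.le hcont hmem
    exact ⟨d, ⟨hd, hd0⟩, fun e he =>
      (hanti a ⟨ha0, ha.2⟩).injOn he.1 hd (he.2.trans hd0.symm)⟩
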